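/- arXiv:2602.08907 — 4 statements merged into one kernel-verified Lean document; each statement's English description precedes it below -/
import Mathlib

section
/- Let d ≥ 3, let S ⊆ {1,…,d} with 2 ≤ |S| ≤ d, and let η ∈ [0,1/2). Let D' = (1/2)·D_{1-2/d} + (1/2)·Unif({-1,1}^d), and let the label be y = ξ·χ_S(x) where ξ ∈ {-1,1} is independent of x with P(ξ=1)=1-η. Then E[y·x_i] = (1/2)(1-2η)(1-2/d)^{|S|-1} for every i ∈ S, E[y·x_i] = (1/2)(1-2η)(1-2/d)^{|S|+1} for every i ∉ S, and the gap Δ := (1/2)(1-2η)(1-2/d)^{|S|-1}·(1-(1-2/d)²) between these two values is strictly positive. -/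
open Finset

/-- The ±1 real value of a Boolean coordinate of the hypercube `{-1,1}^d`. -/
noncomputable def sgn (b : Bool) : ℝ := if b then 1 else -1

/-- Weight of a point `x` of the hypercube `{-1,1}^d` under the product probability
measure `D_μ` whose coordinates are i.i.d., taking the value `1` with probability
`(1+μ)/2` and the value `-1` with probability `(1-μ)/2` (each coordinate has mean `μ`).
Note that `wMu d 0` is the uniform distribution on the hypercube. -/
noncomputable def wMu (d : ℕ) (μ : ℝ) (x : Fin d → Bool) : ℝ :=
  ∏ i, (if x i then (1 + μ) / 2 else (1 - μ) / 2)

/-- The parity function `χ_S(x) = ∏_{i ∈ S} x_i` on the hypercube `{-1,1}^d`. -/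
noncomputable def chi (d : ℕ) (S : Finset (Fin d)) (x : Fin d → Bool) : ℝ :=
  ∏ i ∈ S, sgn (x i)

/-- Weight of `x` under the mixture `D' = (1/2)·D_{1-2/d} + (1/2)·Unif({-1,1}^d)`. -/
noncomputable def wMix (d : ℕ) (x : Fin d → Bool) : ℝ :=
  (1 / 2) * wMu d (1 - 2 / (d : ℝ)) x + (1 / 2) * wMu d 0 x

theorem sgn_mul_self (b : Bool) : sgn b * sgn b = 1 := by
  cases b <;> simp [sgn]

/-- The expectation of the parity `χ_S` under `D_μ` is `μ ^ |S|`. -/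
theorem sum_wMu_mul_chi (d : ℕ) (μ : ℝ) (S : Finset (Fin d)) :
    ∑ x : Fin d → Bool, wMu d μ x * chi d S x = μ ^ S.card := by
  have hcoord (i : Fin d) :
      ∑ b : Bool, (if b then (1 + μ) / 2 else (1 - μ) / 2) * (if i ∈ S then sgn b else 1)
        = if i ∈ S then μ else 1 := by
    by_cases hi : i ∈ S <;> simp [hi, sgn] <;> ring
  calc ∑ x : Fin d → Bool, wMu d μ x * chi d S x
      = ∑ x : Fin d → Bool, ∏ i, (if x i then (1 + μ) / 2 else (1 - μ) / 2) *
          (if i ∈ S then sgn (x i) else 1) := by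
        refine Finset.sum_congr rfl fun x _ => ?_
        rw [Finset.prod_mul_distrib, wMu, chi, Finset.prod_ite_mem, Finset.univ_inter]
    _ = ∏ i : Fin d, if i ∈ S then μ else 1 := by
        simp_rw [← hcoord]
        rw [Finset.prod_univ_sum, Fintype.piFinset_univ]
    _ = μ ^ S.card := by simp

/-- The expectation of a nonconstant parity under the mixture `D'`. -/
theorem sum_wMix_mul_chi (d : ℕ) {S : Finset (Fin d)} (hS : S.Nonempty) :
    ∑ x : Fin d → Bool, wMix d x * chi d S x = (1 / 2) * (1 - 2 / (d : ℝ)) ^ S.card := by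
  simp only [wMix, add_mul, mul_assoc, Finset.sum_add_distrib, ← Finset.mul_sum,
    sum_wMu_mul_chi]
  simp [hS.card_ne_zero]

/-- If `χ_S(x) · x_i = χ_T(x)`, the noisy correlation of the label with `x_i` is determined
by `|T|`. -/
theorem sum_noisy_label_mul_sgn (d : ℕ) (η : ℝ) {S T : Finset (Fin d)} (i : Fin d)
    (hT : T.Nonempty) (h : ∀ x : Fin d → Bool, chi d S x * sgn (x i) = chi d T x) :
    (∑ x : Fin d → Bool, ∑ ξ : Bool,
        wMix d x * (if ξ then 1 - η else η) * (sgn ξ * chi d S x * sgn (x i)))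
      = (1 / 2) * (1 - 2 * η) * (1 - 2 / (d : ℝ)) ^ T.card := by
  calc _ = ∑ x : Fin d → Bool, (1 - 2 * η) * (wMix d x * chi d T x) := by
        refine Finset.sum_congr rfl fun x _ => ?_
        have hχ (ξ : Bool) : sgn ξ * chi d S x * sgn (x i) = sgn ξ * chi d T x := by
          rw [mul_assoc, h]
        simp only [hχ, Fintype.sum_bool]
        simp only [sgn, if_true, Bool.false_eq_true, if_false]
        ring
    _ = _ := by
        rw [← Finset.mul_sum, sum_wMix_mul_chi d hT]
        ring

theorem chi_mul_sgn_of_mem {d : ℕ} {S : Finset (Fin d)} {i : Fin d} (hi : i ∈ S)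
    (x : Fin d → Bool) : chi d S x * sgn (x i) = chi d (S.erase i) x := by
  rw [chi, chi, ← Finset.prod_erase_mul S _ hi, mul_assoc, sgn_mul_self, mul_one]

theorem chi_mul_sgn_of_notMem {d : ℕ} {S : Finset (Fin d)} {i : Fin d} (hi : i ∉ S)
    (x : Fin d → Bool) : chi d S x * sgn (x i) = chi d (insert i S) x := by
  rw [chi, chi, Finset.prod_insert hi, mul_comm]

/-- For `d ≥ 3`, `S ⊆ {1,…,d}` with `2 ≤ |S| ≤ d`, and noise rate `η ∈ [0,1/2)`:
for the training distribution `D' = (1/2)·D_{1-2/d} + (1/2)·Unif({-1,1}^d)` and the noisy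
label `y = ξ·χ_S(x)` with `ξ ∈ {-1,1}` independent of `x` and `P(ξ=1) = 1-η`, one has
`E[y·x_i] = (1/2)(1-2η)(1-2/d)^(|S|-1)` for `i ∈ S`,
`E[y·x_i] = (1/2)(1-2η)(1-2/d)^(|S|+1)` for `i ∉ S`, and the gap
`Δ = (1/2)(1-2η)(1-2/d)^(|S|-1)·(1-(1-2/d)²)` between the two values is positive. -/
theorem stmt1 (d : ℕ) (hd : 3 ≤ d) (S : Finset (Fin d)) (hS : 2 ≤ S.card)
    (η : ℝ) (hη : η ∈ Set.Ico (0 : ℝ) (1 / 2)) :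
    (∀ i ∈ S,
      (∑ x : Fin d → Bool, ∑ ξ : Bool,
          wMix d x * (if ξ then 1 - η else η) * (sgn ξ * chi d S x * sgn (x i)))
        = (1 / 2) * (1 - 2 * η) * (1 - 2 / (d : ℝ)) ^ (S.card - 1)) ∧
    (∀ i ∉ S,
      (∑ x : Fin d → Bool, ∑ ξ : Bool,
          wMix d x * (if ξ then 1 - η else η) * (sgn ξ * chi d S x * sgn (x i)))
        = (1 / 2) * (1 - 2 * η) * (1 - 2 / (d : ℝ)) ^ (S.card + 1)) ∧
    0 < (1 / 2) * (1 - 2 * η) * (1 - 2 / (d : ℝ)) ^ (S.card - 1)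
          * (1 - (1 - 2 / (d : ℝ)) ^ 2) := by
  refine ⟨fun i hi => ?_, fun i hi => ?_, ?_⟩
  · have hne : (S.erase i).Nonempty := by
      rw [← Finset.card_pos, Finset.card_erase_of_mem hi]
      omega
    rw [sum_noisy_label_mul_sgn d η i hne (chi_mul_sgn_of_mem hi),
      Finset.card_erase_of_mem hi]
  · rw [sum_noisy_label_mul_sgn d η i (Finset.insert_nonempty i S) (chi_mul_sgn_of_notMem hi),
      Finset.card_insert_of_notMem hi]
  · have hd' : (3 : ℝ) ≤ d := by exact_mod_cast hd
    have hpos : 0 < 2 / (d : ℝ) := by positivity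
    have hlt : 2 / (d : ℝ) < 1 := by
      rw [div_lt_one (by linarith)]
      linarith
    have hη' : 0 < 1 - 2 * η := by linarith [hη.2]
    have hμ : 0 < 1 - 2 / (d : ℝ) := by linarith
    have hgap : 0 < 1 - (1 - 2 / (d : ℝ)) ^ 2 := by nlinarith
    positivity
end

section
/- Let d ≥ 1 and let S ⊆ {1,…,d} with |S| = k ≥ 1. Then there exist real coefficients (a_b) indexed by the integers b with -k-1 ≤ b ≤ k+1 such that for every x ∈ {-1,1}^d: ∏_{i∈S} x_i = ∑_{b=-k-1}^{k+1} a_b · max(∑_{i∈S} x_i + b, 0). In other words, the parity χ_S is represented exactly on the hypercube by a two-layer ReLU network of width at most 2k+3 whose hidden-layer weight vectors all equal the indicator vector of S and whose biases are integers in [-k-1, k+1]. -/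
open Finset

/-- On `{0, …, N-1}` every function is a combination of the ramps `n ↦ ReLU(n + 1 - j)`, `j < N`. -/
theorem exists_ramp_coeff (f : ℕ → ℝ) (N : ℕ) :
    ∃ c : ℕ → ℝ, ∀ n < N, f n = ∑ j ∈ range N, c j * max ((n : ℝ) + 1 - j) 0 := by
  induction N with
  | zero => exact ⟨0, by simp⟩
  | succ N ih =>
    obtain ⟨c, hc⟩ := ih
    refine ⟨Function.update c N (f N - ∑ j ∈ range N, c j * max ((N : ℝ) + 1 - j) 0), ?_⟩
    intro n hn
    rw [sum_range_succ, Function.update_self]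
    have h : ∀ r : ℝ, ∑ j ∈ range N, Function.update c N r j * max ((n : ℝ) + 1 - j) 0
        = ∑ j ∈ range N, c j * max ((n : ℝ) + 1 - j) 0 := fun r =>
      sum_congr rfl fun j hj => by
        rw [Function.update_of_ne (mem_range.mp hj).ne]
    rw [h]
    rcases Nat.lt_succ_iff_lt_or_eq.mp hn with hlt | rfl
    · have h0 : max ((n : ℝ) + 1 - N) 0 = 0 := max_eq_right <| by
        have : (n : ℝ) + 1 ≤ N := by exact_mod_cast hlt
        linarith
      rw [h0, mul_zero, add_zero, hc n hlt]
    · simp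

/-- The sum and the product of signs over `S` are determined by the number `p` of positive ones. -/
theorem exists_sum_prod_sgn {ι : Type*} (S : Finset ι) (x : ι → Bool) :
    ∃ p ≤ S.card, ∑ i ∈ S, sgn (x i) = 2 * (p : ℝ) - S.card ∧
      ∏ i ∈ S, sgn (x i) = (-1) ^ (S.card + p) := by
  classical
  induction S using Finset.induction_on with
  | empty => exact ⟨0, by simp⟩
  | insert i S hi ih =>
    obtain ⟨p, hp, hsum, hprod⟩ := ih
    rw [card_insert_of_notMem hi, sum_insert hi, prod_insert hi, hsum, hprod]
    cases hx : x i
    · exact ⟨p, by omega, by simp [sgn]; ring, by simp [sgn]; ring⟩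
    · exact ⟨p + 1, by omega, by simp [sgn]; ring, by simp [sgn]; ring⟩

/-- Exact representation of the parity `χ_S` on the hypercube by a two-layer ReLU
network of width at most `2k+3`: there are real coefficients `a_b`, indexed by the
integers `b` with `-k-1 ≤ b ≤ k+1`, such that for every `x ∈ {-1,1}^d`,
`∏_{i∈S} x_i = ∑_{b=-k-1}^{k+1} a_b · ReLU(∑_{i∈S} x_i + b)`.
All hidden units use the weight vector `1_S` and integer biases in `[-k-1, k+1]`. -/
theorem stmt4 (d k : ℕ) (hd : 1 ≤ d) (hk : 1 ≤ k)
    (S : Finset (Fin d)) (hS : S.card = k) :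
    ∃ a : ℤ → ℝ, ∀ x : Fin d → Bool,
      chi d S x =
        ∑ b ∈ Finset.Icc (-(k : ℤ) - 1) ((k : ℤ) + 1),
          a b * max ((∑ i ∈ S, sgn (x i)) + (b : ℝ)) 0 := by
  obtain ⟨c, hc⟩ := exists_ramp_coeff (fun n => (-1) ^ (k + n / 2)) (2 * k + 3)
  refine ⟨fun b => c (k + 1 - b).toNat, fun x => ?_⟩
  obtain ⟨p, hp, hsum, hprod⟩ := exists_sum_prod_sgn S x
  rw [hS] at hp hsum hprod
  have h := hc (2 * p) (by omega)
  simp only [Nat.mul_div_cancel_left p two_pos] at h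
  rw [chi, hprod, h, hsum]
  refine sum_nbij' (fun j => (k : ℤ) + 1 - j) (fun b => (k + 1 - b).toNat) ?_ ?_ ?_ ?_ ?_
  · intro j hj
    simp only [mem_range, mem_Icc] at *
    omega
  · intro b hb
    simp only [mem_range, mem_Icc] at *
    omega
  · intro j _
    simp
  · intro b hb
    simp only [mem_Icc] at hb
    omega
  · intro j _
    simp only [sub_sub_cancel, Int.toNat_natCast]
    push_cast
    congr 2
    ring
end

section
/- For all natural numbers k, s, d with 0 ≤ k ≤ s ≤ d: ∑_{i=k}^{d-s+k} [ C(s,k)·C(d-s, i-k) / C(d,i) ] = (d+1)/(s+1), where C(n,m) denotes the binomial coefficient. -/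
open Finset

/-- The parallel-summation form of Vandermonde's identity. -/
theorem sum_antidiagonal_add_choose_mul_add_choose (k m n : ℕ) :
    ∑ p ∈ antidiagonal n, (k + p.1).choose k * (m + p.2).choose m =
      (k + m + 1 + n).choose (k + m + 1) := by
  have h := congrArg (fun u : (PowerSeries ℤ)ˣ => PowerSeries.coeff n (u : PowerSeries ℤ))
    (PowerSeries.invOneSubPow_add (S := ℤ) (k + 1) (m + 1))
  have e : k + 1 + (m + 1) = (k + m + 1) + 1 := by ring
  simp only [e, Units.val_mul, PowerSeries.invOneSubPow_val_succ_eq_mk_add_choose,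
    PowerSeries.coeff_mul, PowerSeries.coeff_mk] at h
  exact_mod_cast h.symm

/-- Trinomial-type symmetry for ratios of binomial coefficients. -/
theorem choose_mul_choose_div_choose (k m a b : ℕ) :
    ((k + m).choose k : ℝ) * ((a + b).choose a : ℝ) / ((k + m + (a + b)).choose (k + a) : ℝ) =
      ((k + a).choose k : ℝ) * ((m + b).choose m : ℝ) /
        ((k + m + (a + b)).choose (k + m) : ℝ) := by
  have e : k + m + (a + b) = (k + a) + (m + b) := by ring
  rw [Nat.cast_add_choose ℝ (a := k + m) (b := a + b), e,
    Nat.cast_add_choose, Nat.cast_add_choose, Nat.cast_add_choose,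
    Nat.cast_add_choose, Nat.cast_add_choose]
  have h := fun n : ℕ => (Nat.cast_ne_zero (R := ℝ)).2 n.factorial_ne_zero
  have := h k; have := h m; have := h a; have := h b
  have := h (k + m); have := h (a + b); have := h (k + a); have := h (m + b)
  have := h (k + a + (m + b))
  field_simp

/-- For all naturals `k ≤ s ≤ d`:
`∑_{i=k}^{d-s+k} C(s,k)·C(d-s, i-k) / C(d,i) = (d+1)/(s+1)`. -/
theorem stmt6 (d s k : ℕ) (hks : k ≤ s) (hsd : s ≤ d) :
    ∑ i ∈ Finset.Icc k (d - s + k),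
        ((s.choose k : ℝ) * ((d - s).choose (i - k) : ℝ) / (d.choose i : ℝ))
      = ((d : ℝ) + 1) / ((s : ℝ) + 1) := by
  obtain ⟨m, rfl⟩ := Nat.exists_eq_add_of_le hks
  obtain ⟨n, rfl⟩ := Nat.exists_eq_add_of_le hsd
  have hIcc : Icc k (k + m + n - (k + m) + k) = Ico k (k + (n + 1)) := by
    ext i
    simp only [mem_Icc, mem_Ico]
    omega
  rw [hIcc, Finset.sum_Ico_eq_sum_range]
  simp only [Nat.add_sub_cancel_left]
  rw [← Finset.Nat.sum_antidiagonal_eq_sum_range_succ_mk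
    (fun p : ℕ × ℕ => ((k + m).choose k : ℝ) * (n.choose p.1 : ℝ) /
      ((k + m + n).choose (k + p.1) : ℝ))]
  have hterm : ∀ p ∈ antidiagonal n,
      ((k + m).choose k : ℝ) * (n.choose p.1 : ℝ) / ((k + m + n).choose (k + p.1) : ℝ) =
        ((k + p.1).choose k : ℝ) * ((m + p.2).choose m : ℝ) /
          ((k + m + n).choose (k + m) : ℝ) := by
    rintro ⟨a, b⟩ hp
    obtain rfl := mem_antidiagonal.1 hp
    exact choose_mul_choose_div_choose k m a b
  rw [Finset.sum_congr rfl hterm, ← Finset.sum_div]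
  have hsum := congrArg (Nat.cast (R := ℝ)) (sum_antidiagonal_add_choose_mul_add_choose k m n)
  push_cast at hsum
  have hpos : ((k + m + n).choose (k + m) : ℝ) ≠ 0 :=
    Nat.cast_ne_zero.2 (Nat.choose_pos (Nat.le_add_right _ _)).ne'
  have hsucc := congrArg (Nat.cast (R := ℝ)) (Nat.add_one_mul_choose_eq (k + m + n) (k + m))
  rw [show k + m + n + 1 = k + m + 1 + n by ring] at hsucc
  push_cast at hsucc
  rw [hsum, div_eq_div_iff hpos (by positivity)]
  push_cast
  linarith
end

section
/- Let d ≥ 1, let D₂ be the distribution on {-1,1}^d obtained by first drawing l uniformly from {d, d-2, d-4, …, -d} and then drawing x uniformly from the slice {x ∈ {-1,1}^d : ∑_{i=1}^d x_i = l}, and let S ⊆ {1,…,d} with |S| = s ≥ 1. Then for every integer k with 0 ≤ k ≤ s, the D₂-probability that exactly k of the coordinates indexed by S equal +1 is 1/(s+1). Equivalently, ∑_{i∈S} x_i is uniformly distributed on the s+1 values {s, s-2, …, -s}, so each value has probability 1/(s+1) ≥ 1/(d+1). -/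
open Finset

open Classical in
/-- Weight of `x` under the distribution `D₂` on `{-1,1}^d` obtained by first drawing
`l` uniformly from the `d+1` values `{d, d-2, …, -d}` (which are exactly the possible
values of `∑_i x_i`) and then drawing `x` uniformly from the slice
`{x : ∑_i x_i = l}`.  Thus the weight of `x` is `1/(d+1)` times one over the
cardinality of the slice containing `x`. -/
noncomputable def w2 (d : ℕ) (x : Fin d → Bool) : ℝ :=
  (1 / ((d : ℝ) + 1)) *
    (1 / ((Finset.univ.filter
      (fun y : Fin d → Bool => (∑ i, sgn (y i)) = ∑ i, sgn (x i))).card : ℝ))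

/-- The Beta value `B(a + 1, b + 1) = a! b! / (a + b + 1)!`. -/
noncomputable def betaWeight (a b : ℕ) : ℝ :=
  (a.factorial * b.factorial : ℝ) / ((a + b + 1).factorial : ℝ)

lemma betaWeight_succ_add_succ (a b : ℕ) :
    betaWeight a (b + 1) + betaWeight (a + 1) b = betaWeight a b := by
  have h : ((a + b + 1).factorial : ℝ) ≠ 0 := by positivity
  have h' : (a + b + 2 : ℝ) ≠ 0 := by positivity
  have e₁ : a + (b + 1) + 1 = (a + b + 1) + 1 := by ring
  have e₂ : a + 1 + b + 1 = (a + b + 1) + 1 := by ring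
  unfold betaWeight
  rw [e₁, e₂, Nat.factorial_succ (a + b + 1), Nat.factorial_succ a, Nat.factorial_succ b]
  push_cast
  have h'' : (a + b + 1 + 1 : ℝ) ≠ 0 := by positivity
  field_simp
  ring

lemma sum_powerset_betaWeight {α : Type*} [DecidableEq α] (T : Finset α) (a b : ℕ) :
    ∑ A ∈ T.powerset, betaWeight (a + A.card) (b + (T.card - A.card)) = betaWeight a b := by
  induction T using Finset.induction_on generalizing a b with
  | empty => simp
  | insert i T hi ih =>
    rw [Finset.sum_powerset_insert hi, ← betaWeight_succ_add_succ a b, ← ih a (b + 1),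
      ← ih (a + 1) b]
    congr 1 <;> refine Finset.sum_congr rfl fun A hA => ?_
    · have := Finset.card_le_card (Finset.mem_powerset.1 hA)
      rw [Finset.card_insert_of_notMem hi]
      congr 1
      omega
    · have hiA : i ∉ A := fun h => hi (Finset.mem_powerset.1 hA h)
      rw [Finset.card_insert_of_notMem hi, Finset.card_insert_of_notMem hiA]
      congr 1 <;> omega

lemma choose_mul_betaWeight {n k : ℕ} (hk : k ≤ n) :
    (n.choose k : ℝ) * betaWeight k (n - k) = 1 / ((n : ℝ) + 1) := by
  have h : (n.choose k : ℝ) * k.factorial * (n - k).factorial = n.factorial := by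
    exact_mod_cast Nat.choose_mul_factorial_mul_factorial hk
  have h0 : (n.factorial : ℝ) ≠ 0 := by positivity
  have h1 : (n + 1 : ℝ) ≠ 0 := by positivity
  unfold betaWeight
  rw [show k + (n - k) + 1 = n + 1 by omega, Nat.factorial_succ, ← mul_div_assoc, ← mul_assoc, h]
  push_cast
  field_simp

lemma sum_sgn {d : ℕ} (x : Fin d → Bool) :
    ∑ i, sgn (x i) = 2 * ((univ.filter (fun i => x i = true)).card : ℝ) - d := by
  have h : ∀ i, sgn (x i) = 2 * (if x i = true then 1 else 0) - 1 := by
    intro i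
    unfold sgn
    split_ifs <;> norm_num
  simp only [h, Finset.sum_sub_distrib, ← Finset.mul_sum, Finset.sum_boole]
  simp

lemma card_filter_card_eq (d m : ℕ) :
    (univ.filter (fun y : Fin d → Bool =>
      (univ.filter (fun i => y i = true)).card = m)).card = d.choose m := by
  have h := Finset.card_powersetCard m (univ : Finset (Fin d))
  rw [Finset.card_fin] at h
  rw [← h]
  refine Finset.card_nbij' (fun y => univ.filter (fun i => y i = true))
    (fun A i => decide (i ∈ A)) ?_ ?_ ?_ ?_
  · intro y hy
    simpa using hy
  · intro A hA
    simpa using hA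
  · intro y _
    simp
  · intro A _
    simp

lemma w2_eq_betaWeight {d : ℕ} (x : Fin d → Bool) :
    w2 d x = betaWeight (univ.filter (fun i => x i = true)).card
      (d - (univ.filter (fun i => x i = true)).card) := by
  have hm : (univ.filter (fun i => x i = true)).card ≤ d := by
    simpa using Finset.card_le_univ (univ.filter (fun i => x i = true))
  have hc : (d.choose (univ.filter (fun i => x i = true)).card : ℝ) ≠ 0 := by
    exact_mod_cast (Nat.choose_pos hm).ne'
  have hset : ∀ y : Fin d → Bool, (∑ i, sgn (y i) = ∑ i, sgn (x i)) ↔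
      (univ.filter (fun i => y i = true)).card = (univ.filter (fun i => x i = true)).card := by
    intro y
    rw [sum_sgn, sum_sgn, sub_left_inj, mul_right_inj' two_ne_zero, Nat.cast_inj]
  unfold w2
  simp only [hset, card_filter_card_eq]
  rw [← choose_mul_betaWeight hm]
  field_simp

open Classical in
/-- Under `D₂`, for `S ⊆ {1,…,d}` with `|S| = s ≥ 1` and every `0 ≤ k ≤ s`, the
probability that exactly `k` of the coordinates indexed by `S` equal `+1` is
`1/(s+1)`; moreover `1/(s+1) ≥ 1/(d+1)`. -/
theorem stmt7 (d : ℕ) (hd : 1 ≤ d) (S : Finset (Fin d)) (s : ℕ)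
    (hs : S.card = s) (hs1 : 1 ≤ s) (k : ℕ) (hk : k ≤ s) :
    (∑ x ∈ Finset.univ.filter
          (fun x : Fin d → Bool => (S.filter (fun i => x i = true)).card = k),
        w2 d x) = 1 / ((s : ℝ) + 1) ∧
    1 / ((d : ℝ) + 1) ≤ 1 / ((s : ℝ) + 1) := by
  subst hs
  refine ⟨?_, ?_⟩
  · have key : (∑ x ∈ Finset.univ.filter
          (fun x : Fin d → Bool => (S.filter (fun i => x i = true)).card = k), w2 d x) =
        ∑ p ∈ S.powersetCard k ×ˢ Sᶜ.powerset,
          betaWeight (k + p.2.card) ((S.card - k) + (Sᶜ.card - p.2.card)) := by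
      refine Finset.sum_nbij'
        (fun x => (S.filter (fun i => x i = true), Sᶜ.filter (fun i => x i = true)))
        (fun p i => decide (i ∈ p.1 ∪ p.2)) ?_ ?_ ?_ ?_ ?_
      · intro x hx
        simpa [Finset.mem_powersetCard] using hx
      · rintro ⟨B, C⟩ hp
        simp only [mem_product, mem_powersetCard, mem_powerset] at hp
        obtain ⟨⟨hB, hBk⟩, hC⟩ := hp
        have : S.filter (fun i => i ∈ B ∪ C) = B := by
          ext i
          have := @hB i
          have := @hC i
          simp only [mem_filter, mem_union, mem_compl] at *
          tauto
        simp only [mem_filter, mem_univ, true_and, decide_eq_true_eq, this, hBk]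
      · intro x _
        funext i
        by_cases hi : i ∈ S <;> simp [hi]
      · rintro ⟨B, C⟩ hp
        simp only [mem_product, mem_powersetCard, mem_powerset] at hp
        obtain ⟨⟨hB, hBk⟩, hC⟩ := hp
        ext i <;>
        · have := @hB i
          have := @hC i
          simp only [mem_filter, mem_union, mem_compl, decide_eq_true_eq] at *
          tauto
      · intro x hx
        have hxk : (S.filter (fun i => x i = true)).card = k := by simpa using hx
        have hsplit : (univ.filter (fun i => x i = true)).card =
            k + (Sᶜ.filter (fun i => x i = true)).card := by
          rw [← hxk, ← Finset.card_union_of_disjoint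
            (disjoint_filter_filter disjoint_compl_right), ← filter_union, union_compl]
        have hd' : S.card + Sᶜ.card = d := by simp
        have hle := Finset.card_filter_le Sᶜ (fun i => x i = true)
        rw [w2_eq_betaWeight, hsplit]
        dsimp only
        congr 1
        omega
    rw [key, Finset.sum_product]
    simp only [sum_powerset_betaWeight]
    rw [Finset.sum_const, Finset.card_powersetCard, nsmul_eq_mul, choose_mul_betaWeight hk]
  · have h : S.card ≤ d := by simpa using S.card_le_univ
    gcongr
end
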